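/- arXiv:2010.08726 — 5 statements merged into one kernel-verified Lean document; each statement's English description precedes it below -/
import Mathlib

section
/- Let T > 0 and let λ : [0,1]×[0,1] → ℝ be continuous and strictly positive. Let ν : [0,T] → (C([0,1],ℝ))' be a family of continuous linear functionals on C([0,1],ℝ) such that sup_{t∈[0,T]} ‖ν_t‖ < ∞ (operator norm), such that for each f ∈ C([0,1],ℝ) the map s ↦ ν_s(f) is continuous on [0,T], and such that for every f ∈ C([0,1],ℝ) and every t ∈ [0,T], ν_t(f) = ∫₀ᵗ ν_s((P₁ − P₂)f) ds. Then ν_t = 0 for every t ∈ [0,T]. -/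
open MeasureTheory Set

/-- Iterated integration: a bounded family of functionals satisfying `ν_t = ∫₀ᵗ ν_s ∘ A ds`
is bounded by every term of the exponential series of `‖A‖ t`. -/
theorem abs_apply_le_of_eq_integral_comp {E : Type*} [NormedAddCommGroup E] [NormedSpace ℝ E]
    {T M : ℝ} {A : E →L[ℝ] E} {ν : ℝ → (E →L[ℝ] ℝ)}
    (hM : ∀ t ∈ Set.Icc (0:ℝ) T, ‖ν t‖ ≤ M)
    (heq : ∀ f : E, ∀ t ∈ Set.Icc (0:ℝ) T, ν t f = ∫ s in (0:ℝ)..t, ν s (A f))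
    (n : ℕ) (f : E) (t : ℝ) (ht : t ∈ Set.Icc (0:ℝ) T) :
    |ν t f| ≤ M * ‖f‖ * ((‖A‖ * t) ^ n / n.factorial) := by
  have hM0 : 0 ≤ M := (norm_nonneg _).trans (hM t ht)
  induction n generalizing f t with
  | zero => simpa using (ν t).le_of_opNorm_le (hM t ht) f
  | succ n ih =>
    have hbound : ∀ s ∈ Set.Ioc (0:ℝ) t,
        ‖ν s (A f)‖ ≤ M * ‖A f‖ * (‖A‖ ^ n / n.factorial) * s ^ n := fun s hs =>
      (ih (A f) s ⟨hs.1.le, hs.2.trans ht.2⟩).trans_eq (by rw [mul_pow]; ring)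
    rw [heq f t ht, ← Real.norm_eq_abs]
    calc ‖∫ s in (0:ℝ)..t, ν s (A f)‖
        ≤ ∫ s in (0:ℝ)..t, M * ‖A f‖ * (‖A‖ ^ n / n.factorial) * s ^ n :=
          intervalIntegral.norm_integral_le_of_norm_le ht.1 (ae_of_all _ hbound)
            (Continuous.intervalIntegrable (by fun_prop) _ _)
      _ = M * ‖A f‖ * (‖A‖ ^ n * t ^ (n + 1) / (n + 1).factorial) := by
          rw [intervalIntegral.integral_const_mul, integral_pow, Nat.factorial_succ]
          push_cast
          field_simp
          simp
      _ ≤ M * (‖A‖ * ‖f‖) * (‖A‖ ^ n * t ^ (n + 1) / (n + 1).factorial) := by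
          have := ht.1
          gcongr
          exact A.le_opNorm f
      _ = M * ‖f‖ * ((‖A‖ * t) ^ (n + 1) / (n + 1).factorial) := by
          rw [mul_pow]; ring

/-- A bounded family of functionals satisfying `ν_t = ∫₀ᵗ ν_s ∘ A ds` vanishes. -/
theorem eq_zero_of_eq_integral_comp {E : Type*} [NormedAddCommGroup E] [NormedSpace ℝ E]
    {T M : ℝ} {A : E →L[ℝ] E} {ν : ℝ → (E →L[ℝ] ℝ)}
    (hM : ∀ t ∈ Set.Icc (0:ℝ) T, ‖ν t‖ ≤ M)
    (heq : ∀ f : E, ∀ t ∈ Set.Icc (0:ℝ) T, ν t f = ∫ s in (0:ℝ)..t, ν s (A f))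
    (t : ℝ) (ht : t ∈ Set.Icc (0:ℝ) T) : ν t = 0 := by
  ext f
  have hlim := (FloorSemiring.tendsto_pow_div_factorial_atTop (‖A‖ * t)).const_mul (M * ‖f‖)
  rw [mul_zero] at hlim
  exact abs_nonpos_iff.mp <| ge_of_tendsto' hlim fun n =>
    abs_apply_le_of_eq_integral_comp hM heq n f t ht

/-- Uniqueness (Grönwall) part of the weak solution of the hydrodynamic equation: a uniformly
bounded, weakly continuous family of functionals `ν_t` in the dual of `C([0,1],ℝ)` satisfying
`ν_t(f) = ∫₀ᵗ ν_s((P₁−P₂)f) ds` vanishes identically on `[0,T]`. -/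
theorem weak_solution_uniqueness
    (T : ℝ) (hT : 0 < T)
    (lam : (Set.Icc (0:ℝ) 1) × (Set.Icc (0:ℝ) 1) → ℝ)
    (hlam_cont : Continuous lam) (hlam_pos : ∀ p, 0 < lam p)
    (P₁ P₂ : C(Set.Icc (0:ℝ) 1, ℝ) →L[ℝ] C(Set.Icc (0:ℝ) 1, ℝ))
    (hP₁ : ∀ (f : C(Set.Icc (0:ℝ) 1, ℝ)) (x : Set.Icc (0:ℝ) 1),
      P₁ f x = ∫ y : Set.Icc (0:ℝ) 1, lam (x, y) * f y)
    (hP₂ : ∀ (f : C(Set.Icc (0:ℝ) 1, ℝ)) (x : Set.Icc (0:ℝ) 1),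
      P₂ f x = f x * ∫ y : Set.Icc (0:ℝ) 1, lam (x, y))
    (ν : ℝ → (C(Set.Icc (0:ℝ) 1, ℝ) →L[ℝ] ℝ))
    (hbdd : ∃ M : ℝ, ∀ t ∈ Set.Icc (0:ℝ) T, ‖ν t‖ ≤ M)
    (hcont : ∀ f : C(Set.Icc (0:ℝ) 1, ℝ),
      ContinuousOn (fun s => ν s f) (Set.Icc (0:ℝ) T))
    (heq : ∀ (f : C(Set.Icc (0:ℝ) 1, ℝ)), ∀ t ∈ Set.Icc (0:ℝ) T,
      ν t f = ∫ s in (0:ℝ)..t, ν s ((P₁ - P₂) f)) :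
    ∀ t ∈ Set.Icc (0:ℝ) T, ν t = 0 := by
  obtain ⟨M, hM⟩ := hbdd
  exact eq_zero_of_eq_integral_comp hM heq
end

section
/- Let f, g : [0,1] → ℝ be continuous functions with g ≥ 0 and g not identically zero. Then there exists a unique real number C > 0 such that 2C = ∫₀¹ √( f(y)² + 4 g(y) C ) dy. -/
open MeasureTheory Set Real

theorem mul_sqrt_sq_add_le {a b c d : ℝ} (hb : 0 ≤ b) (hc : 0 < c) (hcd : c < d) :
    c * √(a ^ 2 + 4 * b * d) ≤ d * √(a ^ 2 + 4 * b * c) := by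
  have hd := hc.trans hcd
  rw [← sqrt_sq hc.le, ← sqrt_sq hd.le, ← sqrt_mul (sq_nonneg _), ← sqrt_mul (sq_nonneg _),
    sqrt_sq hc.le, sqrt_sq hd.le]
  apply sqrt_le_sqrt
  have h₁ : c ^ 2 * a ^ 2 ≤ d ^ 2 * a ^ 2 := by gcongr
  have h₂ : 0 ≤ b * (c * d * (d - c)) :=
    mul_nonneg hb (mul_nonneg (by positivity) (sub_nonneg.2 hcd.le))
  linarith

theorem mul_sqrt_sq_add_lt {a b c d : ℝ} (hb : 0 < b) (hc : 0 < c) (hcd : c < d) :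
    c * √(a ^ 2 + 4 * b * d) < d * √(a ^ 2 + 4 * b * c) := by
  have hd := hc.trans hcd
  rw [← sqrt_sq hc.le, ← sqrt_sq hd.le, ← sqrt_mul (sq_nonneg _), ← sqrt_mul (sq_nonneg _),
    sqrt_sq hc.le, sqrt_sq hd.le]
  apply sqrt_lt_sqrt (by positivity)
  have h₁ : c ^ 2 * a ^ 2 ≤ d ^ 2 * a ^ 2 := by gcongr
  have h₂ : 0 < b * (c * d * (d - c)) := mul_pos hb (mul_pos (by positivity) (sub_pos.2 hcd))
  linarith

theorem two_mul_mul_sqrt_le_sqrt_sq_add {a b t : ℝ} (ht : 0 ≤ t) :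
    2 * t * √b ≤ √(a ^ 2 + 4 * b * t ^ 2) := by
  rw [← sqrt_sq (by positivity : 0 ≤ 2 * t), ← sqrt_mul (sq_nonneg _)]
  exact sqrt_le_sqrt (by nlinarith [sq_nonneg a])

theorem sqrt_sq_add_le_abs_add {a b t : ℝ} (hb : 0 ≤ b) (ht : 0 ≤ t) :
    √(a ^ 2 + 4 * b * t ^ 2) ≤ |a| + 2 * t * √b := by
  rw [sqrt_le_left (by positivity)]
  have h : 0 ≤ |a| * (t * √b) := by positivity
  nlinarith [sq_sqrt hb, sq_abs a]

theorem isOpenPosMeasure_comap_coe_Icc {a b : ℝ} (hab : a < b) :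
    (volume.comap ((↑) : Icc a b → ℝ)).IsOpenPosMeasure where
  open_pos := by
    rintro _ ⟨V, hV, rfl⟩ ⟨x, hx⟩
    have hx' : (x : ℝ) ∈ closure (Ioo a b) := by rw [closure_Ioo hab.ne]; exact x.2
    have hpos := (hV.inter isOpen_Ioo).measure_pos volume (mem_closure_iff.1 hx' V hV hx)
    rw [comap_subtype_coe_apply measurableSet_Icc, Subtype.image_preimage_coe]
    have hsub : V ∩ Ioo a b ⊆ Icc a b ∩ V := fun y hy => ⟨Ioo_subset_Icc_self hy.2, hy.1⟩
    exact (hpos.trans_le (measure_mono hsub)).ne'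

section

variable {X : Type*} [TopologicalSpace X] [CompactSpace X] [MeasurableSpace X] [BorelSpace X]
  {μ : Measure X} [IsFiniteMeasure μ]

theorem integrable_of_continuous_of_compactSpace {h : X → ℝ} (hh : Continuous h) :
    Integrable h μ :=
  hh.integrable_of_hasCompactSupport (HasCompactSupport.of_compactSpace h)

theorem integral_lt_integral_of_continuous_of_le_of_exists_lt [μ.IsOpenPosMeasure]
    {h k : X → ℝ} (hh : Continuous h) (hk : Continuous k)
    (hle : ∀ x, h x ≤ k x) (hlt : ∃ x, h x < k x) :
    ∫ x, h x ∂μ < ∫ x, k x ∂μ := by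
  obtain ⟨x, hx⟩ := hlt
  rw [← sub_pos, ← integral_sub (integrable_of_continuous_of_compactSpace hk)
    (integrable_of_continuous_of_compactSpace hh)]
  exact (hk.sub hh).integral_pos_of_hasCompactSupport_nonneg_nonzero
    (HasCompactSupport.of_compactSpace _) (fun y => sub_nonneg.2 (hle y)) (sub_pos.2 hx).ne'

theorem eq_of_two_mul_eq_integral_sqrt [μ.IsOpenPosMeasure] {f g : X → ℝ}
    (hf : Continuous f) (hg : Continuous g) (hg_nonneg : ∀ x, 0 ≤ g x) (hg_ne : ∃ x, g x ≠ 0)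
    {C D : ℝ} (hC : 0 < C) (hD : 0 < D)
    (hCeq : 2 * C = ∫ x, √(f x ^ 2 + 4 * g x * C) ∂μ)
    (hDeq : 2 * D = ∫ x, √(f x ^ 2 + 4 * g x * D) ∂μ) : C = D := by
  wlog h : C < D generalizing C D
  · rcases (not_lt.1 h).eq_or_lt with h | h
    · exact h.symm
    · exact (this hD hC hDeq hCeq h).symm
  obtain ⟨x, hx⟩ := hg_ne
  have hlt : ∫ x, C * √(f x ^ 2 + 4 * g x * D) ∂μ < ∫ x, D * √(f x ^ 2 + 4 * g x * C) ∂μ :=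
    integral_lt_integral_of_continuous_of_le_of_exists_lt (by fun_prop) (by fun_prop)
      (fun y => mul_sqrt_sq_add_le (hg_nonneg y) hC h)
      ⟨x, mul_sqrt_sq_add_lt ((hg_nonneg x).lt_of_ne' hx) hC h⟩
  rw [integral_const_mul, integral_const_mul, ← hCeq, ← hDeq] at hlt
  linarith

theorem exists_two_mul_eq_integral_sqrt [μ.IsOpenPosMeasure] {f g : X → ℝ}
    (hf : Continuous f) (hg : Continuous g) (hg_nonneg : ∀ x, 0 ≤ g x) (hg_ne : ∃ x, g x ≠ 0) :
    ∃ C : ℝ, 0 < C ∧ 2 * C = ∫ x, √(f x ^ 2 + 4 * g x * C) ∂μ := by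
  obtain ⟨x, hx⟩ := hg_ne
  set s := ∫ x, √(g x) ∂μ with hs_def
  set F := ∫ x, |f x| ∂μ with hF_def
  have hs : 0 < s := by
    simpa using integral_lt_integral_of_continuous_of_le_of_exists_lt (μ := μ)
      (continuous_const (y := (0 : ℝ))) hg.sqrt (fun y => sqrt_nonneg _)
      ⟨x, sqrt_pos.2 ((hg_nonneg x).lt_of_ne' hx)⟩
  have hF : 0 ≤ F := integral_nonneg fun y => abs_nonneg _
  have hint {h : X → ℝ} (hh : Continuous h) : Integrable h μ :=
    integrable_of_continuous_of_compactSpace hh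
  have hlow : 2 * s ^ 2 ≤ ∫ x, √(f x ^ 2 + 4 * g x * s ^ 2) ∂μ := by
    calc 2 * s ^ 2 = ∫ x, 2 * s * √(g x) ∂μ := by rw [integral_const_mul, ← hs_def]; ring
      _ ≤ _ := integral_mono (hint (by fun_prop)) (hint (by fun_prop))
        fun y => two_mul_mul_sqrt_le_sqrt_sq_add hs.le
  have hupp : ∫ x, √(f x ^ 2 + 4 * g x * (s + F + 1) ^ 2) ∂μ ≤ 2 * (s + F + 1) ^ 2 := by
    calc _ ≤ ∫ x, (|f x| + 2 * (s + F + 1) * √(g x)) ∂μ :=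
          integral_mono (hint (by fun_prop)) (hint (by fun_prop))
            fun y => sqrt_sq_add_le_abs_add (hg_nonneg y) (by positivity)
      _ = F + 2 * (s + F + 1) * s := by
          rw [integral_add (hint (by fun_prop)) (hint (by fun_prop)), integral_const_mul]
      _ ≤ _ := by nlinarith [mul_nonneg hs.le hF]
  have hcont : Continuous fun c : ℝ => ∫ x, √(f x ^ 2 + 4 * g x * c) ∂μ := by
    simpa using continuous_parametric_integral_of_continuous (μ := μ)
      (f := fun (c : ℝ) x => √(f x ^ 2 + 4 * g x * c)) (by fun_prop) isCompact_univ
  have hle : s ^ 2 ≤ (s + F + 1) ^ 2 := by gcongr; linarith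
  obtain ⟨C, hC, hCeq⟩ := intermediate_value_Icc hle
    (f := fun c => 2 * c - ∫ x, √(f x ^ 2 + 4 * g x * c) ∂μ)
    (by fun_prop) ⟨sub_nonpos.2 hlow, sub_nonneg.2 hupp⟩
  exact ⟨C, (pow_pos hs 2).trans_le hC.1, sub_eq_zero.1 hCeq⟩

end

/-- For continuous `f, g : [0,1] → ℝ` with `g ≥ 0` and `g` not identically zero, there is a
unique `C > 0` with `2C = ∫₀¹ √(f(y)² + 4 g(y) C) dy`. -/
theorem exists_unique_fixed_point_sqrt_integral
    (f g : C(Set.Icc (0:ℝ) 1, ℝ))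
    (hg_nonneg : ∀ x, 0 ≤ g x) (hg_ne : ∃ x, g x ≠ 0) :
    ∃! C : ℝ, 0 < C ∧
      2 * C = ∫ y : Set.Icc (0:ℝ) 1, Real.sqrt ((f y) ^ 2 + 4 * g y * C) := by
  have : (volume : Measure (Icc (0 : ℝ) 1)).IsOpenPosMeasure :=
    isOpenPosMeasure_comap_coe_Icc zero_lt_one
  obtain ⟨C, hC, hCeq⟩ := exists_two_mul_eq_integral_sqrt (μ := volume)
    f.continuous g.continuous hg_nonneg hg_ne
  exact ⟨C, ⟨hC, hCeq⟩, fun D hD => eq_of_two_mul_eq_integral_sqrt f.continuous g.continuous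
    hg_nonneg hg_ne hD.1 hC hD.2 hCeq⟩
end

section
/- Let T > 0, let λ₁, λ₂ ∈ C([0,1],ℝ) be strictly positive, and let ψ : [0,T]×[0,1] → ℝ be strictly positive, continuous, with continuous partial derivative ∂_sψ in the time variable, and satisfying ∫₀¹ ∂_sψ(s,x) dx = 0 for every s ∈ [0,T]. Then there exists a continuous function G : [0,T]×[0,1] → ℝ such that for all s ∈ [0,T] and x ∈ [0,1], ∂_sψ(s,x) = ∫₀¹ [ ψ(s,y) λ₁(y) λ₂(x) e^{G(s,x)−G(s,y)} − ψ(s,x) λ₁(x) λ₂(y) e^{G(s,y)−G(s,x)} ] dy. -/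
open MeasureTheory Set Real

section ParametricRoot

variable {S K : Type*} [TopologicalSpace S]

/-- The root of a family of strictly increasing functions depends continuously on the parameter. -/
theorem continuous_of_strictMonoOn_eq {F : S → ℝ → ℝ} {u : S → ℝ} {c : ℝ}
    (hF : ∀ t, Continuous fun s => F s t) (hmono : ∀ s, StrictMonoOn (F s) (Ici 0))
    (hu : ∀ s, 0 < u s) (heq : ∀ s, F s (u s) = c) : Continuous u := by
  refine continuous_iff_continuousAt.2 fun s₀ => tendsto_order.2 ⟨fun l hl => ?_, fun r hr => ?_⟩
  · rcases lt_or_ge l 0 with h0 | h0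
    · exact Filter.Eventually.of_forall fun s => h0.trans (hu s)
    · have h : F s₀ l < c := heq s₀ ▸ hmono s₀ h0 (hu s₀).le hl
      filter_upwards [(hF l).continuousAt.eventually_lt_const h] with s hs
      exact ((hmono s).lt_iff_lt h0 (hu s).le).1 (hs.trans_eq (heq s).symm)
  · have h0 : 0 ≤ r := (hu s₀).le.trans hr.le
    have h : c < F s₀ r := heq s₀ ▸ hmono s₀ (hu s₀).le h0 hr
    filter_upwards [(hF r).continuousAt.eventually_const_lt h] with s hs
    exact ((hmono s).lt_iff_lt (hu s).le h0).1 ((heq s).trans_lt hs)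

variable [TopologicalSpace K] [CompactSpace K] [MeasurableSpace K] [OpensMeasurableSpace K]

theorem Continuous.integrable_of_compactSpace {μ : Measure K} [IsFiniteMeasure μ] {f : K → ℝ}
    (hf : Continuous f) : Integrable f μ :=
  hf.integrable_of_hasCompactSupport (HasCompactSupport.of_compactSpace f)

theorem integral_lt_integral_of_continuous_of_lt {μ : Measure K} [IsProbabilityMeasure μ]
    {f g : K → ℝ} (hf : Continuous f) (hg : Continuous g) (h : ∀ y, f y < g y) :
    ∫ y, f y ∂μ < ∫ y, g y ∂μ := by
  have hfi : Integrable f μ := hf.integrable_of_compactSpace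
  have hgi : Integrable g μ := hg.integrable_of_compactSpace
  rw [← sub_pos, ← integral_sub hgi hfi,
    integral_pos_iff_support_of_nonneg (fun y => (sub_pos.2 (h y)).le) (hgi.sub hfi)]
  have hs : Function.support (fun y => g y - f y) = univ :=
    eq_univ_of_forall fun y => (sub_pos.2 (h y)).ne'
  simp [hs]

/-- Existence and continuous dependence on `s` of the normalising constant `u = 1 / C`. -/
theorem exists_continuous_integral_sqrt_eq_two [FirstCountableTopology S] [LocallyCompactSpace S]
    {μ : Measure K} [IsProbabilityMeasure μ] {a b : S × K → ℝ}
    (ha : Continuous a) (hb : Continuous b) (hb_pos : ∀ p, 0 < b p) :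
    ∃ u : S → ℝ, Continuous u ∧ (∀ s, 0 < u s) ∧
      ∀ s, ∫ y, √((a (s, y) * u s) ^ 2 + b (s, y) * u s) ∂μ = 2 := by
  let F : S → ℝ → ℝ := fun s t => ∫ y, √((a (s, y) * t) ^ 2 + b (s, y) * t) ∂μ
  have hFs (t : ℝ) : Continuous fun s => F s t := by
    simpa only [F, setIntegral_univ] using continuous_parametric_integral_of_continuous (μ := μ)
      (f := fun s y => √((a (s, y) * t) ^ 2 + b (s, y) * t)) (by fun_prop) isCompact_univ
  have hFt (s : S) : Continuous (F s) := by
    simpa only [F, setIntegral_univ] using continuous_parametric_integral_of_continuous (μ := μ)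
      (f := fun t y => √((a (s, y) * t) ^ 2 + b (s, y) * t)) (by fun_prop) isCompact_univ
  have hmono (s : S) : StrictMonoOn (F s) (Ici 0) := by
    intro t ht r _ htr
    refine integral_lt_integral_of_continuous_of_lt (by fun_prop) (by fun_prop) fun y => ?_
    have ht : 0 ≤ t := ht
    have hby := hb_pos (s, y)
    refine sqrt_lt_sqrt (by positivity) (add_lt_add_of_le_of_lt ?_ (by gcongr))
    rw [mul_pow, mul_pow]
    gcongr
  have hroot (s : S) : ∃ t, 0 < t ∧ F s t = 2 := by
    have : Nonempty K := μ.nonempty_of_neZero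
    obtain ⟨y₀, -, hy₀⟩ := isCompact_univ.exists_isMinOn univ_nonempty
      (f := fun y => b (s, y)) (by fun_prop)
    have hm := hb_pos (s, y₀)
    have h0 : F s 0 = 0 := by simp [F]
    have hlarge : 2 ≤ F s (4 / b (s, y₀)) := by
      have hle : ∫ _ : K, (2 : ℝ) ∂μ ≤ F s (4 / b (s, y₀)) := by
        refine integral_mono (integrable_const _)
          (Continuous.integrable_of_compactSpace (by fun_prop)) fun y => le_sqrt_of_sq_le ?_
        have hy : b (s, y₀) ≤ b (s, y) := hy₀ (mem_univ y)
        have : b (s, y₀) * (4 / b (s, y₀)) ≤ b (s, y) * (4 / b (s, y₀)) := by gcongr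
        rw [mul_div_cancel₀ _ hm.ne'] at this
        nlinarith [sq_nonneg (a (s, y) * (4 / b (s, y₀)))]
      simpa using hle
    obtain ⟨t, ht, hFt2⟩ := intermediate_value_Icc (by positivity) (hFt s).continuousOn
      (show (2 : ℝ) ∈ Icc (F s 0) (F s (4 / b (s, y₀))) from ⟨by simp [h0], hlarge⟩)
    refine ⟨t, lt_of_le_of_ne ht.1 ?_, hFt2⟩
    rintro rfl
    simp [h0] at hFt2
  choose u hu heq using hroot
  exact ⟨u, continuous_of_strictMonoOn_eq hFs hmono hu heq, hu, heq⟩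

/-- A strictly positive density with mass-preserving velocity field solves a tilted equation with
product rates, for a continuous tilt. -/
theorem exists_continuous_tilt [FirstCountableTopology S] [LocallyCompactSpace S]
    {μ : Measure K} [IsProbabilityMeasure μ] {l₁ l₂ : K → ℝ} {ψ ψ' : S × K → ℝ}
    (hl₁ : Continuous l₁) (hl₂ : Continuous l₂) (hl₁_pos : ∀ x, 0 < l₁ x) (hl₂_pos : ∀ x, 0 < l₂ x)
    (hψ : Continuous ψ) (hψ' : Continuous ψ') (hψ_pos : ∀ p, 0 < ψ p)
    (hmass : ∀ s, ∫ x, ψ' (s, x) ∂μ = 0) :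
    ∃ G : S × K → ℝ, Continuous G ∧ ∀ s x,
      ψ' (s, x) = ∫ y, (ψ (s, y) * l₁ y * l₂ x * exp (G (s, x) - G (s, y))
        - ψ (s, x) * l₁ x * l₂ y * exp (G (s, y) - G (s, x))) ∂μ := by
  obtain ⟨u, hu_cont, hu, heq⟩ := exists_continuous_integral_sqrt_eq_two (μ := μ)
    (a := ψ') (b := fun p => 4 * (ψ p * l₁ p.2 * l₂ p.2)) hψ' (by fun_prop)
    (fun p => by have := hψ_pos p; have := hl₁_pos p.2; have := hl₂_pos p.2; positivity)
  let r : S × K → ℝ := fun p => √((ψ' p * u p.1) ^ 2 + 4 * (ψ p * l₁ p.2 * l₂ p.2) * u p.1)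
  let h : S × K → ℝ := fun p => (ψ' p * u p.1 + r p) / (2 * l₂ p.2)
  have hr_cont : Continuous r := by fun_prop
  have hc (p : S × K) : 0 < ψ p * l₁ p.2 * l₂ p.2 * u p.1 := by
    have := hψ_pos p; have := hl₁_pos p.2; have := hl₂_pos p.2; have := hu p.1; positivity
  have hr_sq (p : S × K) :
      r p ^ 2 = (ψ' p * u p.1) ^ 2 + 4 * (ψ p * l₁ p.2 * l₂ p.2) * u p.1 :=
    sq_sqrt (by nlinarith [hc p, sq_nonneg (ψ' p * u p.1)])
  have hnum (p : S × K) : 0 < ψ' p * u p.1 + r p := by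
    have : |ψ' p * u p.1| < r p :=
      abs_lt.2 (abs_lt_of_sq_lt_sq' (by nlinarith [hr_sq p, hc p]) (sqrt_nonneg _))
    linarith [neg_abs_le (ψ' p * u p.1)]
  have hh (p : S × K) : 0 < h p := div_pos (hnum p) (mul_pos two_pos (hl₂_pos _))
  have hh_cont : Continuous h :=
    Continuous.div (by fun_prop) (by fun_prop) fun p => (mul_pos two_pos (hl₂_pos p.2)).ne'
  have hl₂h (p : S × K) : l₂ p.2 * h p = (ψ' p * u p.1 + r p) / 2 := by
    have := (hl₂_pos p.2).ne'
    simp only [h]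
    field_simp
  have hquad (p : S × K) : ψ p * l₁ p.2 / h p = (l₂ p.2 * h p) / u p.1 - ψ' p := by
    have h1 := (hh p).ne'
    have h2 := (hu p.1).ne'
    have h3 : l₂ p.2 * (l₂ p.2 * h p * h p - ψ' p * u p.1 * h p - ψ p * l₁ p.2 * u p.1) = 0 := by
      linear_combination (l₂ p.2 * h p + (ψ' p * u p.1 + r p) / 2 - ψ' p * u p.1) * hl₂h p
        + hr_sq p / 4
    have h4 := (mul_eq_zero.1 h3).resolve_left (hl₂_pos p.2).ne'
    field_simp
    linear_combination -h4
  have hint {f : S × K → ℝ} (hf : Continuous f) (s : S) : Integrable (fun y => f (s, y)) μ :=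
    Continuous.integrable_of_compactSpace (by fun_prop)
  have hB (s : S) : ∫ y, l₂ y * h (s, y) ∂μ = 1 := by
    calc ∫ y, l₂ y * h (s, y) ∂μ = ∫ y, (ψ' (s, y) * u s + r (s, y)) / 2 ∂μ :=
          integral_congr_ae (.of_forall fun y => hl₂h (s, y))
      _ = ((∫ y, ψ' (s, y) ∂μ) * u s + ∫ y, r (s, y) ∂μ) / 2 := by
          rw [integral_div, integral_add ((hint hψ' s).mul_const _) (hint hr_cont s),
            integral_mul_const]
      _ = 1 := by
          rw [hmass, show ∫ y, r (s, y) ∂μ = 2 from heq s]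
          norm_num
  have hA (s : S) : ∫ y, ψ (s, y) * l₁ y / h (s, y) ∂μ = 1 / u s := by
    calc ∫ y, ψ (s, y) * l₁ y / h (s, y) ∂μ = ∫ y, (l₂ y * h (s, y) / u s - ψ' (s, y)) ∂μ :=
          integral_congr_ae (.of_forall fun y => hquad (s, y))
      _ = 1 / u s := by
          rw [integral_sub (Continuous.integrable_of_compactSpace (by fun_prop)) (hint hψ' s),
            integral_div, hB, hmass, sub_zero]
  refine ⟨fun p => log (h p), hh_cont.log fun p => (hh p).ne', fun s x => ?_⟩
  have hAi : Integrable (fun y => ψ (s, y) * l₁ y / h (s, y)) μ :=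
    Continuous.integrable_of_compactSpace
      (Continuous.div (by fun_prop) (by fun_prop) fun y => (hh (s, y)).ne')
  have hBi : Integrable (fun y => l₂ y * h (s, y)) μ :=
    Continuous.integrable_of_compactSpace (by fun_prop)
  symm
  calc _ = ∫ y, (l₂ x * h (s, x) * (ψ (s, y) * l₁ y / h (s, y))
          - ψ (s, x) * l₁ x / h (s, x) * (l₂ y * h (s, y))) ∂μ := by
        refine integral_congr_ae (.of_forall fun y => ?_)
        simp only [exp_sub, exp_log (hh _)]
        ring
    _ = l₂ x * h (s, x) * (1 / u s) - ψ (s, x) * l₁ x / h (s, x) := by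
        rw [integral_sub (hAi.const_mul _) (hBi.const_mul _), integral_const_mul,
          integral_const_mul, hA, hB, mul_one]
    _ = ψ' (s, x) := by
        rw [hquad (s, x)]
        ring

end ParametricRoot

/-- Key step of Lemma 6.1 under Assumption (B): any strictly positive, mass-conserving
`C^{1,0}` density path `ψ` solves a tilted hydrodynamic equation with product rates
`λ(x,y) = λ₁(x)λ₂(y)` for some continuous tilt `G`. -/
theorem exists_continuous_tilt_of_mass_conserving_path
    (T : ℝ) (hT : 0 < T)
    (lam₁ lam₂ : C(Set.Icc (0:ℝ) 1, ℝ))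
    (hlam₁ : ∀ x, 0 < lam₁ x) (hlam₂ : ∀ x, 0 < lam₂ x)
    (ψ ψ' : ℝ × Set.Icc (0:ℝ) 1 → ℝ)
    (hψ_pos : ∀ s ∈ Set.Icc (0:ℝ) T, ∀ x : Set.Icc (0:ℝ) 1, 0 < ψ (s, x))
    (hψ_cont : ContinuousOn ψ (Set.Icc (0:ℝ) T ×ˢ Set.univ))
    (hψ'_cont : ContinuousOn ψ' (Set.Icc (0:ℝ) T ×ˢ Set.univ))
    (hψ_deriv : ∀ (x : Set.Icc (0:ℝ) 1), ∀ s ∈ Set.Icc (0:ℝ) T,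
      HasDerivWithinAt (fun s => ψ (s, x)) (ψ' (s, x)) (Set.Icc (0:ℝ) T) s)
    (hmass : ∀ s ∈ Set.Icc (0:ℝ) T, ∫ x : Set.Icc (0:ℝ) 1, ψ' (s, x) = 0) :
    ∃ G : ℝ × Set.Icc (0:ℝ) 1 → ℝ,
      ContinuousOn G (Set.Icc (0:ℝ) T ×ˢ Set.univ) ∧
      ∀ s ∈ Set.Icc (0:ℝ) T, ∀ x : Set.Icc (0:ℝ) 1,
        ψ' (s, x) = ∫ y : Set.Icc (0:ℝ) 1,
          (ψ (s, y) * lam₁ y * lam₂ x * exp (G (s, x) - G (s, y))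
            - ψ (s, x) * lam₁ x * lam₂ y * exp (G (s, y) - G (s, x))) := by
  let clamp : ℝ × Set.Icc (0:ℝ) 1 → ℝ × Set.Icc (0:ℝ) 1 := fun p => (projIcc 0 T hT.le p.1, p.2)
  have hclamp : Continuous clamp := by
    have := continuous_projIcc (h := hT.le)
    fun_prop
  have hclamp_mem (p) : clamp p ∈ Set.Icc (0:ℝ) T ×ˢ (Set.univ : Set (Set.Icc (0:ℝ) 1)) :=
    ⟨(projIcc 0 T hT.le p.1).2, mem_univ _⟩
  have hclamp_eq {s : ℝ} (hs : s ∈ Set.Icc (0:ℝ) T) (x) : clamp (s, x) = (s, x) := by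
    simp [clamp, projIcc_of_mem hT.le hs]
  obtain ⟨G, hG, hG_eq⟩ := exists_continuous_tilt (μ := (volume : Measure (Set.Icc (0:ℝ) 1)))
    lam₁.continuous lam₂.continuous hlam₁ hlam₂
    (hψ_cont.comp_continuous hclamp hclamp_mem) (hψ'_cont.comp_continuous hclamp hclamp_mem)
    (fun p => hψ_pos _ (hclamp_mem p).1 _) (fun s => hmass _ (projIcc 0 T hT.le s).2)
  refine ⟨G, hG.continuousOn, fun s hs x => ?_⟩
  simpa only [Function.comp_apply, hclamp_eq hs] using hG_eq s x
end

section
/- Let φ ∈ C([0,1],ℝ) be strictly positive and let ψ₀ ∈ C([0,1],ℝ) be nonnegative. Then sup { ∫₀¹ ψ₀(x)H(x) dx − ∫₀¹ φ(x)(e^{H(x)} − 1) dx : H ∈ C([0,1],ℝ) } = ∫₀¹ [ ψ₀(x) log ψ₀(x) − ψ₀(x) log φ(x) + φ(x) − ψ₀(x) ] dx, with the convention 0·log 0 = 0. -/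
open MeasureTheory Set Real

/-- The Fenchel–Young inequality for the Poisson cost `h ↦ p * (exp h - 1)`. -/
theorem mul_sub_mul_exp_sub_one_le {a p : ℝ} (ha : 0 ≤ a) (hp : 0 < p) (h : ℝ) :
    a * h - p * (exp h - 1) ≤ a * log a - a * log p + p - a := by
  rcases ha.eq_or_lt with rfl | ha
  · have := mul_pos hp (exp_pos h)
    simp only [zero_mul]
    linarith
  · have key := mul_le_mul_of_nonneg_left (add_one_le_exp (h + log p - log a)) ha.le
    have hexp : a * exp (h + log p - log a) = p * exp h := by
      rw [exp_sub, exp_add, exp_log hp, exp_log ha]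
      field_simp
    linarith

/-- Near-optimality of `h = log (a + δ) - log p` in the Fenchel–Young inequality for the
Poisson cost. -/
theorem sub_le_mul_log_sub_mul_exp_sub_one {a p δ : ℝ} (ha : 0 ≤ a) (hp : 0 < p) (hδ : 0 < δ) :
    a * log a - a * log p + p - a - δ
      ≤ a * (log (a + δ) - log p) - p * (exp (log (a + δ) - log p) - 1) := by
  have hexp : p * exp (log (a + δ) - log p) = a + δ := by
    rw [exp_sub, exp_log hp, exp_log (by positivity)]
    field_simp
  have hlog : a * log a ≤ a * log (a + δ) := by
    rcases ha.eq_or_lt with rfl | ha'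
    · simp
    · gcongr
      linarith
  linarith

/-- The Legendre transform of the log-Laplace functional of a Poisson random measure with
intensity `φ • μ`, evaluated at `ψ • μ`. -/
theorem isLUB_integral_sub_integral_exp {X : Type*} [TopologicalSpace X] [CompactSpace X]
    [MeasurableSpace X] [BorelSpace X] (μ : Measure X) [IsFiniteMeasure μ]
    (φ ψ : C(X, ℝ)) (hφ : ∀ x, 0 < φ x) (hψ : ∀ x, 0 ≤ ψ x) :
    IsLUB {r : ℝ | ∃ H : C(X, ℝ),
        r = (∫ x, ψ x * H x ∂μ) - ∫ x, φ x * (exp (H x) - 1) ∂μ}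
      (∫ x, (ψ x * log (ψ x) - ψ x * log (φ x) + φ x - ψ x) ∂μ) := by
  have integrable {f : X → ℝ} (hf : Continuous f) : Integrable f μ :=
    hf.integrable_of_hasCompactSupport (HasCompactSupport.of_compactSpace f)
  have hlogφ : Continuous fun x => log (φ x) := φ.continuous.log fun x => (hφ x).ne'
  have hrate : Integrable (fun x => ψ x * log (ψ x) - ψ x * log (φ x) + φ x - ψ x) μ :=
    integrable <| (((continuous_mul_log.comp ψ.continuous).sub
      (ψ.continuous.mul hlogφ)).add φ.continuous).sub ψ.continuous
  have hlin (H : C(X, ℝ)) : Integrable (fun x => ψ x * H x) μ := integrable (by fun_prop)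
  have hcost (H : C(X, ℝ)) : Integrable (fun x => φ x * (exp (H x) - 1)) μ :=
    integrable (by fun_prop)
  constructor
  · rintro _ ⟨H, rfl⟩
    rw [← integral_sub (hlin H) (hcost H)]
    exact integral_mono ((hlin H).sub (hcost H)) hrate
      fun x => mul_sub_mul_exp_sub_one_le (hψ x) (hφ x) (H x)
  · intro b hb
    refine le_of_forall_pos_le_add fun ε hε => ?_
    set δ : ℝ := ε / (μ.real univ + 1)
    have hδ : 0 < δ := by positivity
    have hδε : μ.real univ * δ ≤ ε := by
      have : (μ.real univ + 1) * δ = ε := by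
        simp only [δ]
        field_simp
      linarith
    let H : C(X, ℝ) := ⟨fun x => log (ψ x + δ) - log (φ x),
      ((ψ.continuous.add continuous_const).log
        fun x => (add_pos_of_nonneg_of_pos (hψ x) hδ).ne').sub hlogφ⟩
    have hH := hb ⟨H, rfl⟩
    rw [← integral_sub (hlin H) (hcost H)] at hH
    have hle := integral_mono (hrate.sub (integrable_const δ)) ((hlin H).sub (hcost H))
      fun x => sub_le_mul_log_sub_mul_exp_sub_one (hψ x) (hφ x) hδ
    simp only [Pi.sub_apply] at hle
    rw [integral_sub hrate (integrable_const δ), integral_const, smul_eq_mul] at hle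
    linarith

/-- Explicit formula for the initial large deviation rate function `I_ini` of independent
Poisson initial data with mean profile `φ`, at a measure with density `ψ₀`. In Lean,
`Real.log 0 = 0`, which implements the convention `0·log 0 = 0`. -/
theorem initial_rate_function_formula
    (φ ψ₀ : C(Set.Icc (0:ℝ) 1, ℝ))
    (hφ : ∀ x, 0 < φ x) (hψ₀ : ∀ x, 0 ≤ ψ₀ x) :
    sSup {r : ℝ | ∃ H : C(Set.Icc (0:ℝ) 1, ℝ),
        r = (∫ x : Set.Icc (0:ℝ) 1, ψ₀ x * H x)
            - ∫ x : Set.Icc (0:ℝ) 1, φ x * (exp (H x) - 1)}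
      = ∫ x : Set.Icc (0:ℝ) 1,
          (ψ₀ x * Real.log (ψ₀ x) - ψ₀ x * Real.log (φ x) + φ x - ψ₀ x) := by
  exact (isLUB_integral_sub_integral_exp volume φ ψ₀ hφ hψ₀).csSup_eq ⟨_, 0, rfl⟩
end

section
/- Let T > 0, let λ : [0,1]×[0,1] → ℝ be continuous and strictly positive, and let ψ : [0,T]×[0,1] → ℝ be continuous with continuous partial derivative ∂_sψ in the time variable. For H ∈ C([0,T]×[0,1],ℝ) define ϑ(H) = ∫₀ᵀ∫₀¹ ∂_sψ(s,x) H(s,x) dx ds − ∫₀ᵀ∫₀¹∫₀¹ ψ(s,x) λ(x,y) ( e^{H(s,y)−H(s,x)} − 1 ) dy dx ds. Then sup over all G : [0,T]×[0,1] → ℝ continuous with continuous time derivative of the quantity ∫₀¹ ψ(T,x)G(T,x) dx − ∫₀¹ ψ(0,x)G(0,x) dx − ∫₀ᵀ∫₀¹ ψ(s,x) ( ∂_sG(s,x) + (𝓑G(s,·))(x) ) dx ds equals sup over all H ∈ C([0,T]×[0,1],ℝ) of ϑ(H), where (𝓑f)(x) = ∫₀¹ λ(x,y)( e^{f(y)−f(x)}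 − 1 ) dy for f ∈ C([0,1],ℝ). -/
open MeasureTheory Set Real

namespace DynamicalRate

/-- The functional `ϑ` on test functions that are merely continuous in time. -/
noncomputable def theta (T : ℝ) (lam : Icc (0:ℝ) 1 × Icc (0:ℝ) 1 → ℝ)
    (ψ ψ' H : ℝ × Icc (0:ℝ) 1 → ℝ) : ℝ :=
  (∫ s in (0:ℝ)..T, ∫ x : Icc (0:ℝ) 1, ψ' (s, x) * H (s, x))
    - ∫ s in (0:ℝ)..T, ∫ x : Icc (0:ℝ) 1, ∫ y : Icc (0:ℝ) 1,
        ψ (s, x) * lam (x, y) * (exp (H (s, y) - H (s, x)) - 1)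

/-- The functional defining `I_dyn` on test functions `G` with time derivative `G'`. -/
noncomputable def dynFunctional (T : ℝ) (lam : Icc (0:ℝ) 1 × Icc (0:ℝ) 1 → ℝ)
    (ψ G G' : ℝ × Icc (0:ℝ) 1 → ℝ) : ℝ :=
  (∫ x : Icc (0:ℝ) 1, ψ (T, x) * G (T, x))
    - (∫ x : Icc (0:ℝ) 1, ψ (0, x) * G (0, x))
    - ∫ s in (0:ℝ)..T, ∫ x : Icc (0:ℝ) 1,
        ψ (s, x) * (G' (s, x)
          + ∫ y : Icc (0:ℝ) 1, lam (x, y) * (exp (G (s, y) - G (s, x)) - 1))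

/-- Constant extension in time of a function on `[0, T]`. -/
noncomputable def extendTime {X : Type*} {T : ℝ} (hT : 0 ≤ T) (f : ℝ × X → ℝ) : ℝ × X → ℝ :=
  fun z => f ((projIcc 0 T hT z.1 : ℝ), z.2)

theorem continuous_extendTime {X : Type*} [TopologicalSpace X] {T : ℝ} (hT : 0 ≤ T)
    {f : ℝ × X → ℝ} (hf : ContinuousOn f (Icc (0:ℝ) T ×ˢ univ)) :
    Continuous (extendTime hT f) := by
  refine hf.comp_continuous (f := fun z : ℝ × X => ((projIcc 0 T hT z.1 : ℝ), z.2)) ?_ ?_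
  · exact ((continuous_subtype_val.comp continuous_projIcc).comp continuous_fst).prodMk
      continuous_snd
  · exact fun z => ⟨(projIcc 0 T hT z.1).2, mem_univ _⟩

theorem extendTime_of_mem {X : Type*} {T : ℝ} (hT : 0 ≤ T) (f : ℝ × X → ℝ) {s : ℝ}
    (hs : s ∈ Icc (0:ℝ) T) (x : X) : extendTime hT f (s, x) = f (s, x) := by
  simp [extendTime, projIcc_of_mem hT hs]

theorem hasDerivAt_extendTime {X : Type*} {T : ℝ} (hT : 0 ≤ T) {f f' : ℝ × X → ℝ}
    (h : ∀ x, ∀ s ∈ Icc (0:ℝ) T,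
      HasDerivWithinAt (fun s => f (s, x)) (f' (s, x)) (Icc (0:ℝ) T) s)
    (x : X) {s : ℝ} (hs : s ∈ Ioo (0:ℝ) T) :
    HasDerivAt (fun s => extendTime hT f (s, x)) (extendTime hT f' (s, x)) s := by
  have hs' := Ioo_subset_Icc_self hs
  have hn : Icc (0:ℝ) T ∈ nhds s := Icc_mem_nhds hs.1 hs.2
  rw [extendTime_of_mem hT f' hs']
  refine ((h x s hs').hasDerivAt hn).congr_of_eventuallyEq ?_
  filter_upwards [hn] with t ht using extendTime_of_mem hT f ht x

theorem theta_congr {T : ℝ} (hT : 0 ≤ T) (lam : Icc (0:ℝ) 1 × Icc (0:ℝ) 1 → ℝ)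
    {ψ ψ' H φ φ' K : ℝ × Icc (0:ℝ) 1 → ℝ}
    (hψ : ∀ s ∈ Icc (0:ℝ) T, ∀ x, ψ (s, x) = φ (s, x))
    (hψ' : ∀ s ∈ Icc (0:ℝ) T, ∀ x, ψ' (s, x) = φ' (s, x))
    (hH : ∀ s ∈ Icc (0:ℝ) T, ∀ x, H (s, x) = K (s, x)) :
    theta T lam ψ ψ' H = theta T lam φ φ' K := by
  unfold theta
  congr 1 <;> refine intervalIntegral.integral_congr fun s hs => ?_ <;>
    rw [uIcc_of_le hT] at hs
  · simp only [hψ' s hs, hH s hs]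
  · simp only [hψ s hs, hH s hs]

theorem dynFunctional_congr {T : ℝ} (hT : 0 ≤ T) (lam : Icc (0:ℝ) 1 × Icc (0:ℝ) 1 → ℝ)
    {ψ G G' φ K K' : ℝ × Icc (0:ℝ) 1 → ℝ}
    (hψ : ∀ s ∈ Icc (0:ℝ) T, ∀ x, ψ (s, x) = φ (s, x))
    (hG : ∀ s ∈ Icc (0:ℝ) T, ∀ x, G (s, x) = K (s, x))
    (hG' : ∀ s ∈ Icc (0:ℝ) T, ∀ x, G' (s, x) = K' (s, x)) :
    dynFunctional T lam ψ G G' = dynFunctional T lam φ K K' := by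
  have h0 : (0:ℝ) ∈ Icc (0:ℝ) T := ⟨le_rfl, hT⟩
  have h1 : T ∈ Icc (0:ℝ) T := ⟨hT, le_rfl⟩
  unfold dynFunctional
  simp only [hψ T h1, hψ 0 h0, hG T h1, hG 0 h0]
  congr 1
  refine intervalIntegral.integral_congr fun s hs => ?_
  rw [uIcc_of_le hT] at hs
  simp only [hψ s hs, hG s hs, hG' s hs]

theorem continuous_integral_param {X Y : Type*} [TopologicalSpace X] [TopologicalSpace Y]
    [FirstCountableTopology X] [LocallyCompactSpace X] [CompactSpace Y]
    [MeasurableSpace Y] [OpensMeasurableSpace Y] {μ : Measure Y} [IsLocallyFiniteMeasure μ]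
    {f : X → Y → ℝ} (hf : Continuous (Function.uncurry f)) :
    Continuous fun x => ∫ y, f x y ∂μ := by
  simpa using continuous_parametric_integral_of_continuous (μ := μ) hf isCompact_univ

theorem integrable_of_continuous {Y : Type*} [TopologicalSpace Y] [CompactSpace Y]
    [MeasurableSpace Y] [OpensMeasurableSpace Y] {μ : Measure Y} [IsFiniteMeasureOnCompacts μ]
    {f : Y → ℝ} (hf : Continuous f) : Integrable f μ :=
  hf.integrable_of_hasCompactSupport (HasCompactSupport.of_compactSpace f)

theorem dynFunctional_eq_theta_of_continuous {T : ℝ} (hT : 0 ≤ T)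
    {lam : Icc (0:ℝ) 1 × Icc (0:ℝ) 1 → ℝ} (hlam : Continuous lam)
    {ψ ψ' G G' : ℝ × Icc (0:ℝ) 1 → ℝ} (hψ : Continuous ψ) (hψ' : Continuous ψ')
    (hG : Continuous G) (hG' : Continuous G')
    (hψd : ∀ x, ∀ s ∈ Ioo (0:ℝ) T, HasDerivAt (fun s => ψ (s, x)) (ψ' (s, x)) s)
    (hGd : ∀ x, ∀ s ∈ Ioo (0:ℝ) T, HasDerivAt (fun s => G (s, x)) (G' (s, x)) s) :
    dynFunctional T lam ψ G G' = theta T lam ψ ψ' G := by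
  have hB : Continuous fun z : ℝ × Icc (0:ℝ) 1 =>
      ∫ y, lam (z.2, y) * (exp (G (z.1, y) - G z) - 1) :=
    continuous_integral_param (by unfold Function.uncurry; fun_prop)
  have parts : (∫ x, ψ (T, x) * G (T, x)) - (∫ x, ψ (0, x) * G (0, x))
      = ∫ s in (0:ℝ)..T, ∫ x, (ψ' (s, x) * G (s, x) + ψ (s, x) * G' (s, x)) := by
    rw [intervalIntegral_integral_swap, ← integral_sub]
    · refine integral_congr_ae (.of_forall fun x => ?_)
      refine (intervalIntegral.integral_eq_sub_of_hasDerivAt_of_le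
        (f := fun s => ψ (s, x) * G (s, x)) hT ?_ ?_ ?_).symm
      · exact Continuous.continuousOn (by fun_prop)
      · exact fun s hs => (hψd x s hs).mul (hGd x s hs)
      · exact Continuous.intervalIntegrable (by fun_prop) _ _
    · exact integrable_of_continuous (by fun_prop)
    · exact integrable_of_continuous (by fun_prop)
    · rw [← Measure.restrict_univ (μ := (volume : Measure (Icc (0:ℝ) 1))),
        Measure.prod_restrict, uIoc_of_le hT]
      refine IntegrableOn.mono_set ?_ (prod_mono Ioc_subset_Icc_self subset_rfl)
      refine ContinuousOn.integrableOn_compact (isCompact_Icc.prod isCompact_univ) ?_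
      exact Continuous.continuousOn (by unfold Function.uncurry; fun_prop)
  have hc : ∀ F : ℝ × Icc (0:ℝ) 1 → ℝ, Continuous F →
      IntervalIntegrable (fun s => ∫ x, F (s, x)) volume 0 T := fun F hF =>
    (continuous_integral_param (by unfold Function.uncurry; fun_prop)).intervalIntegrable _ _
  unfold dynFunctional theta
  rw [parts, ← intervalIntegral.integral_sub, ← intervalIntegral.integral_sub]
  · refine intervalIntegral.integral_congr fun s _ => ?_
    have hBs : Continuous fun x : Icc (0:ℝ) 1 =>
      ∫ y, lam (x, y) * (exp (G (s, y) - G (s, x)) - 1) :=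
      hB.comp (continuous_const.prodMk continuous_id)
    simp only [mul_assoc, integral_const_mul]
    rw [← integral_sub, ← integral_sub]
    · exact integral_congr_ae (.of_forall fun x => by ring)
    all_goals exact integrable_of_continuous (by fun_prop)
  · exact hc (fun z => ψ' z * G z) (by fun_prop)
  · simp only [mul_assoc, integral_const_mul]
    exact hc (fun z => ψ z * ∫ y, lam (z.2, y) * (exp (G (z.1, y) - G z) - 1)) (by fun_prop)
  · exact hc (fun z => ψ' z * G z + ψ z * G' z) (by fun_prop)
  · exact hc (fun z => ψ z * (G' z + ∫ y, lam (z.2, y) * (exp (G (z.1, y) - G z) - 1)))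
      (by fun_prop)

theorem dynFunctional_eq_theta {T : ℝ} (hT : 0 ≤ T)
    {lam : Icc (0:ℝ) 1 × Icc (0:ℝ) 1 → ℝ} (hlam : Continuous lam)
    {ψ ψ' G G' : ℝ × Icc (0:ℝ) 1 → ℝ}
    (hψ : ContinuousOn ψ (Icc (0:ℝ) T ×ˢ univ)) (hψ' : ContinuousOn ψ' (Icc (0:ℝ) T ×ˢ univ))
    (hG : ContinuousOn G (Icc (0:ℝ) T ×ˢ univ)) (hG' : ContinuousOn G' (Icc (0:ℝ) T ×ˢ univ))
    (hψd : ∀ x, ∀ s ∈ Icc (0:ℝ) T,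
      HasDerivWithinAt (fun s => ψ (s, x)) (ψ' (s, x)) (Icc (0:ℝ) T) s)
    (hGd : ∀ x, ∀ s ∈ Icc (0:ℝ) T,
      HasDerivWithinAt (fun s => G (s, x)) (G' (s, x)) (Icc (0:ℝ) T) s) :
    dynFunctional T lam ψ G G' = theta T lam ψ ψ' G := by
  have ext (f : ℝ × Icc (0:ℝ) 1 → ℝ) (s) (hs : s ∈ Icc (0:ℝ) T) (x) :
      f (s, x) = extendTime hT f (s, x) := (extendTime_of_mem hT f hs x).symm
  rw [dynFunctional_congr hT lam (ext ψ) (ext G) (ext G'),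
    theta_congr hT lam (ext ψ) (ext ψ') (ext G)]
  exact dynFunctional_eq_theta_of_continuous hT hlam (continuous_extendTime hT hψ)
    (continuous_extendTime hT hψ') (continuous_extendTime hT hG) (continuous_extendTime hT hG')
    (fun x _ hs => hasDerivAt_extendTime hT hψd x hs)
    (fun x _ hs => hasDerivAt_extendTime hT hGd x hs)

/-- The average of `H` over the time interval `[s, s + h]`, equal to `H` for `h = 0`. -/
noncomputable def timeAverage {X : Type*} (H : ℝ × X → ℝ) (h : ℝ) (z : ℝ × X) : ℝ :=
  ∫ u in (0:ℝ)..1, H (z.1 + h * u, z.2)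

theorem timeAverage_zero {X : Type*} (H : ℝ × X → ℝ) : timeAverage H 0 = H := by
  ext z
  simp [timeAverage]

theorem continuous_timeAverage {X : Type*} [TopologicalSpace X] {H : ℝ × X → ℝ}
    (hH : Continuous H) : Continuous fun q : ℝ × ℝ × X => timeAverage H q.1 q.2 :=
  intervalIntegral.continuous_parametric_intervalIntegral_of_continuous'
    (by unfold Function.uncurry; fun_prop) 0 1

theorem hasDerivAt_timeAverage {X : Type*} [TopologicalSpace X] {H : ℝ × X → ℝ}
    (hH : Continuous H) {h : ℝ} (hh : h ≠ 0) (s : ℝ) (x : X) :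
    HasDerivAt (fun s => timeAverage H h (s, x)) (h⁻¹ * (H (s + h, x) - H (s, x))) s := by
  have hc : Continuous fun t => H (t, x) := by fun_prop
  have hI (a b : ℝ) : IntervalIntegrable (fun t => H (t, x)) volume a b :=
    hc.intervalIntegrable a b
  have hP (b : ℝ) : HasDerivAt (fun u => ∫ t in (0:ℝ)..u, H (t, x)) (H (b, x)) b :=
    intervalIntegral.integral_hasDerivAt_right (hI 0 b) (hc.stronglyMeasurableAtFilter _ _)
      hc.continuousAt
  have heq : (fun s => timeAverage H h (s, x)) = fun s =>
      h⁻¹ * ((∫ t in (0:ℝ)..(s + h), H (t, x)) - ∫ t in (0:ℝ)..s, H (t, x)) := by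
    ext s
    rw [intervalIntegral.integral_interval_sub_left (hI _ _) (hI _ _)]
    simpa [timeAverage] using
      intervalIntegral.integral_comp_add_mul (a := 0) (b := 1) (fun t => H (t, x)) hh s
  rw [heq]
  exact (((hP (s + h)).comp_add_const s h).sub (hP s)).const_mul _

theorem continuous_theta {T : ℝ} {lam : Icc (0:ℝ) 1 × Icc (0:ℝ) 1 → ℝ} (hlam : Continuous lam)
    {ψ ψ' : ℝ × Icc (0:ℝ) 1 → ℝ} (hψ : Continuous ψ) (hψ' : Continuous ψ')
    {Y : Type*} [TopologicalSpace Y] [FirstCountableTopology Y] [LocallyCompactSpace Y]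
    {F : Y → ℝ × Icc (0:ℝ) 1 → ℝ} (hF : Continuous (Function.uncurry F)) :
    Continuous fun h => theta T lam ψ ψ' (F h) := by
  unfold theta
  refine Continuous.sub ?_ ?_ <;>
    refine intervalIntegral.continuous_parametric_intervalIntegral_of_continuous' ?_ 0 T
  · refine continuous_integral_param (X := Y × ℝ)
      (f := fun q x => ψ' (q.2, x) * F q.1 (q.2, x)) ?_
    exact (by fun_prop : Continuous fun p : (Y × ℝ) × Icc (0:ℝ) 1 => ψ' (p.1.2, p.2)).mul
      (hF.comp (by fun_prop : Continuous
        fun p : (Y × ℝ) × Icc (0:ℝ) 1 => (p.1.1, (p.1.2, p.2))))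
  · refine continuous_integral_param (X := Y × ℝ)
      (f := fun q x => ∫ y, ψ (q.2, x) * lam (x, y) * (exp (F q.1 (q.2, y) - F q.1 (q.2, x)) - 1))
      (continuous_integral_param (X := (Y × ℝ) × Icc (0:ℝ) 1) ?_)
    have h1 : Continuous fun p : ((Y × ℝ) × Icc (0:ℝ) 1) × Icc (0:ℝ) 1 =>
        F p.1.1.1 (p.1.1.2, p.2) :=
      hF.comp (by fun_prop : Continuous
        fun p : ((Y × ℝ) × Icc (0:ℝ) 1) × Icc (0:ℝ) 1 => (p.1.1.1, (p.1.1.2, p.2)))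
    have h2 : Continuous fun p : ((Y × ℝ) × Icc (0:ℝ) 1) × Icc (0:ℝ) 1 =>
        F p.1.1.1 (p.1.1.2, p.1.2) :=
      hF.comp (by fun_prop : Continuous
        fun p : ((Y × ℝ) × Icc (0:ℝ) 1) × Icc (0:ℝ) 1 => (p.1.1.1, (p.1.1.2, p.1.2)))
    unfold Function.uncurry
    fun_prop

theorem sSup_eq_of_subset_of_subset_closure {A B : Set ℝ} (hAB : A ⊆ B)
    (hBA : B ⊆ closure A) : sSup A = sSup B := by
  have hub : upperBounds A = upperBounds B :=
    (upperBounds_closure A ▸ upperBounds_mono_set hBA).antisymm (upperBounds_mono_set hAB)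
  rcases A.eq_empty_or_nonempty with rfl | hA
  · rw [closure_empty, subset_empty_iff] at hBA
    rw [hBA]
  by_cases hb : BddAbove A
  · have h := isLUB_csSup hA hb
    rw [IsLUB, hub] at h
    exact (IsLUB.csSup_eq h (hA.mono hAB)).symm
  · have hb' : ¬ BddAbove B := fun h => hb (h.mono hAB)
    rw [Real.sSup_of_not_bddAbove hb, Real.sSup_of_not_bddAbove hb']

end DynamicalRate

open DynamicalRate

/-- The dynamical rate function `I_dyn`, defined as a supremum over time-differentiable test
functions `G` (via the generator `𝓑`), coincides with the supremum over merely continuous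
test functions `H` of the functional `ϑ`. -/
theorem dynamical_rate_function_sup_eq
    (T : ℝ) (hT : 0 < T)
    (lam : (Set.Icc (0:ℝ) 1) × (Set.Icc (0:ℝ) 1) → ℝ)
    (hlam_cont : Continuous lam) (hlam_pos : ∀ p, 0 < lam p)
    (ψ ψ' : ℝ × Set.Icc (0:ℝ) 1 → ℝ)
    (hψ_cont : ContinuousOn ψ (Set.Icc (0:ℝ) T ×ˢ Set.univ))
    (hψ'_cont : ContinuousOn ψ' (Set.Icc (0:ℝ) T ×ˢ Set.univ))
    (hψ_deriv : ∀ (x : Set.Icc (0:ℝ) 1), ∀ s ∈ Set.Icc (0:ℝ) T,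
      HasDerivWithinAt (fun s => ψ (s, x)) (ψ' (s, x)) (Set.Icc (0:ℝ) T) s) :
    sSup {r : ℝ | ∃ G G' : ℝ × Set.Icc (0:ℝ) 1 → ℝ,
        ContinuousOn G (Set.Icc (0:ℝ) T ×ˢ Set.univ) ∧
        ContinuousOn G' (Set.Icc (0:ℝ) T ×ˢ Set.univ) ∧
        (∀ (x : Set.Icc (0:ℝ) 1), ∀ s ∈ Set.Icc (0:ℝ) T,
          HasDerivWithinAt (fun s => G (s, x)) (G' (s, x)) (Set.Icc (0:ℝ) T) s) ∧
        r = (∫ x : Set.Icc (0:ℝ) 1, ψ (T, x) * G (T, x))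
            - (∫ x : Set.Icc (0:ℝ) 1, ψ (0, x) * G (0, x))
            - ∫ s in (0:ℝ)..T, ∫ x : Set.Icc (0:ℝ) 1,
                ψ (s, x) * (G' (s, x)
                  + ∫ y : Set.Icc (0:ℝ) 1,
                      lam (x, y) * (exp (G (s, y) - G (s, x)) - 1))}
      = sSup {r : ℝ | ∃ H : ℝ × Set.Icc (0:ℝ) 1 → ℝ,
          ContinuousOn H (Set.Icc (0:ℝ) T ×ˢ Set.univ) ∧
          r = (∫ s in (0:ℝ)..T, ∫ x : Set.Icc (0:ℝ) 1, ψ' (s, x) * H (s, x))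
              - ∫ s in (0:ℝ)..T, ∫ x : Set.Icc (0:ℝ) 1, ∫ y : Set.Icc (0:ℝ) 1,
                  ψ (s, x) * lam (x, y) * (exp (H (s, y) - H (s, x)) - 1)} := by
  have hT' := hT.le
  refine sSup_eq_of_subset_of_subset_closure ?_ ?_
  · rintro r ⟨G, G', hG, hG', hGd, rfl⟩
    exact ⟨G, hG, dynFunctional_eq_theta hT' hlam_cont hψ_cont hψ'_cont hG hG' hψ_deriv hGd⟩
  rintro r ⟨H, hH, rfl⟩
  change theta T lam ψ ψ' H ∈ _
  have ext (f : ℝ × Icc (0:ℝ) 1 → ℝ) (s) (hs : s ∈ Icc (0:ℝ) T) (x) :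
      f (s, x) = extendTime hT' f (s, x) := (extendTime_of_mem hT' f hs x).symm
  have hHc := continuous_extendTime hT' hH
  have hav := continuous_timeAverage hHc
  have hcont := (continuous_theta (T := T) hlam_cont (continuous_extendTime hT' hψ_cont)
    (continuous_extendTime hT' hψ'_cont) (F := timeAverage (extendTime hT' H)) hav).tendsto 0
  rw [timeAverage_zero, ← theta_congr hT' lam (ext ψ) (ext ψ') (ext H)] at hcont
  refine mem_closure_of_tendsto (hcont.mono_left (nhdsWithin_le_nhds (s := {0}ᶜ))) ?_
  filter_upwards [self_mem_nhdsWithin] with h hh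
  have hGc : Continuous (timeAverage (extendTime hT' H) h) :=
    hav.comp (continuous_const.prodMk continuous_id)
  have hG'c : Continuous fun z : ℝ × Icc (0:ℝ) 1 =>
      h⁻¹ * (extendTime hT' H (z.1 + h, z.2) - extendTime hT' H (z.1, z.2)) := by fun_prop
  have hGd (x : Icc (0:ℝ) 1) (s : ℝ) (_ : s ∈ Icc (0:ℝ) T) :=
    (hasDerivAt_timeAverage hHc hh s x).hasDerivWithinAt (s := Icc (0:ℝ) T)
  refine ⟨_, _, hGc.continuousOn, hG'c.continuousOn, hGd, ?_⟩
  rw [← theta_congr hT' lam (ext ψ) (ext ψ') fun _ _ _ => rfl]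
  exact (dynFunctional_eq_theta hT' hlam_cont hψ_cont hψ'_cont hGc.continuousOn
    hG'c.continuousOn hψ_deriv hGd).symm
end
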